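/- Decision lemma: if κ ∈ K, 2^{<θ_κ} < κ, p ∈ Q, and p forces that ȧ is an ordinal (in the forcing Q), then there exist q and (r_i : i < i*) in Q with i* < (2^{<θ_κ})⁺, p ≤^{pr}_κ q, q ≤^{apr}_κ r_i for all i < i*, each r_i decides the value of ȧ, and {r_i : i < i*} is predense above q. -/

import Mathlib

open Cardinal Set

noncomputable section

attribute [local instance] Classical.propDecidable

/-- A forcing condition: a partial `{0,1}`-valued function on ordinals,
coded as an `Option Bool`-valued function. -/
abbrev Cond : Type 1 := Ordinal → Option Bool

/-- The domain of a condition. -/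
def cdom (q : Cond) : Set Ordinal := {i | (q i).isSome}

/-- The `E_κ`-equivalence class of `i` : `j E_κ i` iff `j + κ = i + κ` (ordinal addition). -/
def Ecl (κ : Cardinal) (i : Ordinal) : Set Ordinal := {j | j + κ.ord = i + κ.ord}

/-- The `E_{<κ}`-class of `i`, where `E_{<κ} = id ∪ ⋃ {E_θ : θ ∈ K ∩ κ}`. -/
def EclLt (K : Set Cardinal) (κ : Cardinal) (i : Ordinal) : Set Ordinal :=
  {i} ∪ ⋃ θ ∈ K ∩ Set.Iio κ, Ecl θ i

/-- `θ_κ` : the least regular cardinal `≥ sup((K ∩ κ) ∪ {λ})`. -/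
def theta (lam : Cardinal) (K : Set Cardinal) (κ : Cardinal) : Cardinal :=
  sInf {θ : Cardinal | θ.IsRegular ∧ sSup ((K ∩ Set.Iio κ) ∪ {lam}) ≤ θ}

/-- `A` grows from `X` to `Y` : `∅ ≠ A ∩ X ≠ A ∩ Y`. -/
def grows (A X Y : Set Ordinal) : Prop := (A ∩ X).Nonempty ∧ A ∩ X ≠ A ∩ Y

/-- Membership in the forcing `Q = Q_K`. -/
def inQ (lam mu : Cardinal) (K : Set Cardinal) (q : Cond) : Prop :=
  cdom q ⊆ Set.Iio mu.ord ∧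
    ∀ i < mu.ord, ∀ κ ∈ K, #↥(Ecl κ i ∩ cdom q) < Cardinal.lift.{1} (theta lam K κ)

/-- The set of `E_κ`-classes which grow from `X` to `Y`. -/
def growClasses (mu : Cardinal) (κ : Cardinal) (X Y : Set Ordinal) : Set (Set Ordinal) :=
  {A | (∃ i < mu.ord, A = Ecl κ i) ∧ grows A X Y}

/-- The forcing order: `p ⊆ q` and for each `κ ∈ K`, fewer than `θ_κ` many
`E_κ`-classes grow from `dom p` to `dom q`. -/
def condLe (lam mu : Cardinal) (K : Set Cardinal) (p q : Cond) : Prop :=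
  (∀ i b, p i = some b → q i = some b) ∧
    ∀ κ ∈ K, #↥(growClasses mu κ (cdom p) (cdom q)) < Cardinal.lift.{1} (theta lam K κ)

/-- Pure extension at `κ`: no `E_κ`-class represented in `dom p` grows. -/
def condLePr (lam mu : Cardinal) (K : Set Cardinal) (κ : Cardinal) (p q : Cond) : Prop :=
  condLe lam mu K p q ∧ ∀ i : Ordinal, ¬ grows (Ecl κ i) (cdom p) (cdom q)

/-- Apure extension at `κ`: no new `E_κ`-classes are represented in `dom q`. -/
def condLeApr (lam mu : Cardinal) (K : Set Cardinal) (κ : Cardinal) (p q : Cond) : Prop :=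
  condLe lam mu K p q ∧ ∀ i ∈ cdom q, (Ecl κ i ∩ cdom p).Nonempty

/-- Union of two conditions (as partial functions, left priority). -/
def unionC (p q : Cond) : Cond := fun i => (p i).orElse (fun _ => q i)

/-- Restriction of a condition to a set of ordinals. -/
def restrictC (q : Cond) (X : Set Ordinal) : Cond := fun ξ => if ξ ∈ X then q ξ else none

/-- Union of a family of conditions indexed by ordinals below `θo`. -/
def unionFam (f : Ordinal → Cond) (θo : Ordinal) : Cond :=
  fun ξ => if h : ∃ i, i < θo ∧ (f i ξ).isSome then f h.choose ξ else none

/-- Compatibility in `Q`: existence of a common upper bound in `Q`. -/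
def compatQ (lam mu : Cardinal) (K : Set Cardinal) (q₁ q₂ : Cond) : Prop :=
  ∃ r : Cond, inQ lam mu K r ∧ condLe lam mu K q₁ r ∧ condLe lam mu K q₂ r

/-- Standing ground-model hypotheses: `λ = λ^{<λ}` regular, `μ = μ^λ` regular,
`K ⊆ [λ, μ]` a set of regular cardinals with `λ, μ ∈ K`. -/
def GroundCtx (lam mu : Cardinal) (K : Set Cardinal) : Prop :=
  lam.IsRegular ∧ lam ^< lam = lam ∧ mu.IsRegular ∧ mu ^ lam = mu ∧
    (∀ κ ∈ K, κ.IsRegular ∧ lam ≤ κ ∧ κ ≤ mu) ∧ lam ∈ K ∧ mu ∈ K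




universe u

theorem aux_card_Iio (θ : Cardinal.{u}) (ν : Cardinal.{u}) (h : ν < θ) :
    ∃ a : θ.ord.ToType, #(Iio a) = ν := by
  refine ⟨Ordinal.ToType.mk ⟨ν.ord, ord_lt_ord.2 h⟩, ?_⟩
  rw [← Cardinal.lift_inj.{u, u+1}]
  have e : (Iio (Ordinal.ToType.mk ⟨ν.ord, ord_lt_ord.2 h⟩ : θ.ord.ToType)) ≃ Iio ν.ord :=
    { toFun := fun x => ⟨x.1.toOrd, by
        have := x.2
        have h2 := (Ordinal.ToType.mk (o := θ.ord)).symm.lt_iff_lt.2 this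
        rw [OrderIso.symm_apply_apply] at h2
        exact h2⟩
      invFun := fun y => ⟨Ordinal.ToType.mk ⟨y.1, lt_trans y.2 (ord_lt_ord.2 h)⟩, by
        apply (Ordinal.ToType.mk (o := θ.ord)).lt_iff_lt.2
        exact y.2⟩
      left_inv := fun x => by
        apply Subtype.ext
        exact (Ordinal.ToType.mk (o := θ.ord)).apply_symm_apply x.1
      right_inv := fun y => by
        apply Subtype.ext
        simp }
  have h1 := Cardinal.lift_mk_eq'.2 ⟨e⟩
  rw [Cardinal.mk_Iio_ordinal, card_ord] at h1
  simpa using h1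

theorem aux_card_S (c m : Cardinal.{u}) :
    #{x : c.ord.ToType | #(Iio x) < m} ≤ m := by
  rw [← Cardinal.lift_le.{u+1}]
  have : Cardinal.lift.{u+1} #{x : c.ord.ToType | #(Iio x) < m} ≤ Cardinal.lift.{u} #(Iio m.ord) := by
    apply Cardinal.lift_mk_le'.2
    refine ⟨⟨fun x => ⟨Ordinal.typein (α := c.ord.ToType) (· < ·) x.1, ?_⟩, ?_⟩⟩
    · have h := x.2
      simp only [mem_ofPred_eq] at h
      rw [mem_Iio, lt_ord]
      exact h
    · intro x y hxy
      have := congrArg Subtype.val hxy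
      exact Subtype.ext (Ordinal.typein_injective _ this)
  rw [Cardinal.mk_Iio_ordinal, card_ord] at this
  simpa using this

theorem theta_le_powerlt (θ : Cardinal.{u}) : θ ≤ 2 ^< θ := by
  by_contra h
  push Not at h
  exact absurd (le_powerlt 2 h) (not_le.2 (cantor _))

theorem powerlt_pow_le (θ : Cardinal.{u}) (hθ : θ.IsRegular) (η : Cardinal.{u}) (hη : η < θ) :
    (2 ^< θ) ^ η ≤ 2 ^< θ := by
  set c := 2 ^< θ with hc
  have hcθ : θ ≤ c := theta_le_powerlt θ
  induction η using Cardinal.inductionOn with | _ T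
  let B := c.ord.ToType
  have hB : #B = c := mk_ord_toType c
  have hx : ∀ x : B, ∃ ν : Cardinal.{u}, ν < θ ∧ #(Iio x) < 2 ^ ν := by
    intro x
    have h : #(Iio x) < c := mk_Iio_toType_ord_lt x
    by_contra hcon
    push Not at hcon
    exact absurd (powerlt_le.2 hcon) (not_le.2 h)
  choose ν hνθ hν using hx
  let S : θ.ord.ToType → Set B := fun a => {x | #(Iio x) < 2 ^ #(Iio a)}
  have hU : (Set.univ : Set (T → B)) ⊆ ⋃ a : θ.ord.ToType, {g | ∀ t, g t ∈ S a} := by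
    intro g _
    have h0 : (⨆ t, ν (g t)) < θ := iSup_lt_of_isRegular hθ hη (fun t => hνθ _)
    obtain ⟨a, ha⟩ := aux_card_Iio θ _ h0
    refine mem_iUnion.2 ⟨a, fun t => ?_⟩
    change #(Iio (g t)) < 2 ^ #(Iio a)
    rw [ha]
    refine (hν _).trans_le (power_le_power_left two_ne_zero ?_)
    exact le_ciSup (bddAbove_range _) t
  calc c ^ #T = #(T → B) := by rw [← hB]; simp
    _ = #(Set.univ : Set (T → B)) := mk_univ.symm
    _ ≤ #(⋃ a : θ.ord.ToType, {g : T → B | ∀ t, g t ∈ S a}) := mk_le_mk_of_subset hU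
    _ ≤ sum fun a : θ.ord.ToType => #{g : T → B | ∀ t, g t ∈ S a} := mk_iUnion_le_sum_mk
    _ ≤ sum fun a : θ.ord.ToType => c := by
        apply sum_le_sum
        intro a
        calc #{g : T → B | ∀ t, g t ∈ S a} ≤ #(T → S a) :=
              mk_le_of_injective (f := fun g t => ⟨g.1 t, g.2 t⟩) (by
                intro g g' h
                apply Subtype.ext
                funext t
                exact congrArg Subtype.val (congrFun h t))
          _ = #(S a) ^ #T := by simp
          _ ≤ (2 ^ #(Iio a)) ^ #T := power_le_power_right (aux_card_S _ _)
          _ = 2 ^ (#(Iio a) * #T) := (power_mul ..).symm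
          _ ≤ c := le_powerlt 2 (mul_lt_of_lt hθ.aleph0_le (mk_Iio_toType_ord_lt a) hη)
    _ ≤ c := by
        rw [sum_const, mk_ord_toType]
        simpa using mul_le_of_le (hθ.aleph0_le.trans hcθ) hcθ le_rfl

/-- strong chain condition. -/
theorem strong_cc {ι Y : Type u} [Nonempty Y] (θ : Cardinal.{u}) (hθ : θ.IsRegular)
    (s : Setoid Y) (hs : ∀ y, #{z | s y z} ≤ 2 ^< θ)
    (F : ι → Set Y) (hF : ∀ i, #(F i) < θ) (hι : 2 ^< θ < #ι) :
    ∃ i j, i ≠ j ∧ ∀ y ∈ F i, ∀ z ∈ F j, s y z → ∀ w, s y w → (w ∈ F i ↔ w ∈ F j) := by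
  classical
  set c := 2 ^< θ with hc
  have hcθ : θ ≤ c := theta_le_powerlt θ
  have hc0 : ℵ₀ ≤ c := hθ.aleph0_le.trans hcθ
  let P := c.ord.ToType
  have hP : #P = c := mk_ord_toType c
  have hιne : Nonempty ι := by
    rw [← mk_ne_zero_iff]; exact (lt_of_le_of_lt (zero_le) hι).ne'
  -- saturation
  let sat : Set Y → Set Y := fun G => {z | ∃ y ∈ G, s y z}
  have hsat : ∀ i, #(sat (F i)) ≤ c := by
    intro i
    have : sat (F i) = ⋃ y : F i, {z | s y z} := by
      ext z; simp [sat]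
    rw [this]
    calc _ ≤ sum fun y : F i => #{z | s y z} := mk_iUnion_le_sum_mk
      _ ≤ sum fun y : F i => c := sum_le_sum _ _ (fun y => hs y)
      _ ≤ c := by
        rw [sum_const]
        simpa using mul_le_of_le hc0 ((hF i).le.trans hcθ) le_rfl
  have henum : ∀ i, ∃ e : P → Y, sat (F i) ⊆ range e := by
    intro i
    have h1 : #(sat (F i)) ≤ #P := by rw [hP]; exact hsat i
    obtain ⟨f⟩ := h1
    refine ⟨Function.extend f Subtype.val (fun _ => Classical.arbitrary Y), fun y hy => ⟨f ⟨y, hy⟩, ?_⟩⟩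
    rw [f.injective.extend_apply]
  choose e he using henum
  let ok : Set Y → ι → Prop := fun G i => ∀ w ∈ sat G, (w ∈ F i ↔ w ∈ G)
  let Φ : Set Y → ι := fun G => if h : ∃ i, ok G i then h.choose else Classical.arbitrary ι
  have hΦ : ∀ G i, ok G i → ok G (Φ G) := by
    intro G i h
    have h' : ∃ i, ok G i := ⟨i, h⟩
    simp only [Φ, dif_pos h']
    exact h'.choose_spec
  let α := θ.ord.ToType × P
  let β : α → Type u := fun a => Iio a.1
  let ev : WType β → Y := fun w => WType.elim Y (fun x => e (Φ (range x.2)) x.1.2) w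
  let A : WType β → ι := fun w => match w with
    | WType.mk a f => Φ (range fun b => ev (f b))
  have hW : #(WType β) ≤ c := by
    apply WType.cardinalMk_le_of_le
    calc (sum fun a : α => c ^ #(β a)) ≤ sum fun a : α => c :=
          sum_le_sum _ _ (fun a => powerlt_pow_le θ hθ _ (mk_Iio_toType_ord_lt a.1))
      _ ≤ c := by
        rw [sum_const]
        have : #α ≤ c := by
          have h1 : #α = θ * c := by simp [α, P]
          rw [h1]; exact mul_le_of_le hc0 hcθ le_rfl
        simpa using mul_le_of_le hc0 this le_rfl
  obtain ⟨i, hi⟩ : ∃ i, i ∉ range A := by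
    by_contra hcon
    push Not at hcon
    have : range A = Set.univ := eq_univ_of_forall hcon
    have h1 : #(range A) = #ι := by rw [this, mk_univ]
    exact absurd ((h1.symm.le.trans mk_range_le).trans hW) (not_le.2 hι)
  let D : Set Y := ⋃ w, sat (F (A w))
  have hDsat : ∀ y ∈ D, ∀ z, s y z → z ∈ D := by
    intro y hy z hz
    obtain ⟨w, y0, hy0, h⟩ := mem_iUnion.1 hy
    exact mem_iUnion.2 ⟨w, y0, hy0, s.trans h hz⟩
  have hDev : D ⊆ range ev := by
    intro y hy
    obtain ⟨w, hw⟩ := mem_iUnion.1 hy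
    obtain ⟨⟨a, q⟩, f⟩ := w
    obtain ⟨p, hp⟩ := he _ hw
    exact ⟨WType.mk (a, p) f, hp⟩
  let G := F i ∩ D
  have hG : #G < θ := (mk_le_mk_of_subset inter_subset_left).trans_lt (hF i)
  obtain ⟨a, ha⟩ := aux_card_Iio θ _ hG
  obtain ⟨φ⟩ := Cardinal.eq.1 ha
  have hP0 : Nonempty P := by
    rw [← mk_ne_zero_iff, hP]; exact (aleph0_pos.trans_le hc0).ne'
  have hpre : ∀ g : G, ∃ w, ev w = g := fun g => hDev g.2.2
  choose pre hprev using hpre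
  let w0 : WType β := WType.mk (a, Classical.arbitrary P) (fun b => pre (φ b))
  have hA0 : A w0 = Φ G := by
    change Φ (range fun b => ev (pre (φ b))) = Φ G
    congr 1
    ext y
    constructor
    · rintro ⟨b, rfl⟩
      simp only [hprev]
      exact (φ b).2
    · intro hy
      obtain ⟨b, hb⟩ := φ.surjective ⟨y, hy⟩
      refine ⟨b, ?_⟩
      simp only [hprev]
      rw [hb]
  have hoki : ok G i := by
    rintro w ⟨y, hy, hyw⟩
    exact ⟨fun h => ⟨h, hDsat y hy.2 w hyw⟩, fun h => h.1⟩
  have hok := hΦ G i hoki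
  refine ⟨i, Φ G, ?_, ?_⟩
  · intro h
    exact hi ⟨w0, hA0.trans h.symm⟩
  · intro y hy z hz hyz w hyw
    have hyD : y ∈ D := by
      refine mem_iUnion.2 ⟨w0, z, ?_, s.symm hyz⟩
      rw [hA0]; exact hz
    have hw : w ∈ sat G := ⟨y, ⟨hy, hyD⟩, hyw⟩
    rw [hoki w hw, hok w hw]

/-! ### Basic facts about classes -/

theorem Ecl_self (κ : Cardinal.{0}) (x : Ordinal.{0}) : x ∈ Ecl κ x := rfl

theorem Ecl_eq {κ : Cardinal.{0}} {x y : Ordinal.{0}} (h : y ∈ Ecl κ x) : Ecl κ y = Ecl κ x := by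
  have h' : y + κ.ord = x + κ.ord := h
  ext z
  change z + κ.ord = y + κ.ord ↔ z + κ.ord = x + κ.ord
  rw [h']

theorem Ecl_mono {ν κ : Cardinal.{0}} (hκ : ℵ₀ ≤ κ) (h : ν ≤ κ) (x : Ordinal.{0}) :
    Ecl ν x ⊆ Ecl κ x := by
  rcases h.eq_or_lt with rfl | h
  · exact le_rfl
  intro y hy
  have hy' : y + ν.ord = x + ν.ord := hy
  have habs : ν.ord + κ.ord = κ.ord :=
    (Ordinal.isPrincipal_add_iff_add_left_eq_self.1 (Ordinal.isPrincipal_add_ord hκ)) _ (ord_lt_ord.2 h)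
  change y + κ.ord = x + κ.ord
  rw [← habs, ← add_assoc, hy', add_assoc]

theorem Ecl_card (κ : Cardinal.{0}) (h0 : κ ≠ 0) (x : Ordinal.{0}) : #(Ecl κ x) ≤ Cardinal.lift.{1} κ := by
  have hne : (Ecl κ x).Nonempty := ⟨x, Ecl_self κ x⟩
  set m := sInf (Ecl κ x) with hm
  have hmm : m ∈ Ecl κ x := csInf_mem hne
  have hle : ∀ y ∈ Ecl κ x, m ≤ y := fun y hy => csInf_le' hy
  have hlt : ∀ y ∈ Ecl κ x, y - m < κ.ord ∨ κ.ord = 0 := by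
    intro y hy
    by_contra hcon
    push Not at hcon
    obtain ⟨h1, h2⟩ := hcon
    have e : m + (y - m) = y := Ordinal.add_sub_cancel_of_le (hle y hy)
    have h3 : m + κ.ord ≤ y := by rw [← e]; gcongr
    have h4 : y + κ.ord = m + κ.ord := by
      rw [show y + κ.ord = x + κ.ord from hy, show m + κ.ord = x + κ.ord from hmm]
    have h5 : y < y + κ.ord := by
      exact lt_add_of_pos_right y (pos_iff_ne_zero.2 h2)
    rw [h4] at h5
    exact absurd h5 (not_lt.2 h3)
  have h0' : κ.ord ≠ 0 := by simpa using h0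
  have : #(Ecl κ x) ≤ #(Iio κ.ord) := by
    refine mk_le_of_injective (f := fun y => ⟨y.1 - m, (hlt y.1 y.2).resolve_right h0'⟩) ?_
    intro y z hyz
    have hyz' : y.1 - m = z.1 - m := congrArg Subtype.val hyz
    apply Subtype.ext
    rw [← Ordinal.add_sub_cancel_of_le (hle y.1 y.2), hyz',
      Ordinal.add_sub_cancel_of_le (hle z.1 z.2)]
  rw [Cardinal.mk_Iio_ordinal, card_ord] at this
  exact this

theorem grows_iff {A X Y : Set Ordinal.{0}} (h : X ⊆ Y) :
    grows A X Y ↔ (A ∩ X).Nonempty ∧ ∃ x ∈ A, x ∈ Y ∧ x ∉ X := by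
  refine and_congr_right fun _ => ⟨fun hne => ?_, ?_⟩
  · by_contra hcon
    push Not at hcon
    exact hne (Subset.antisymm (inter_subset_inter_right _ h) fun x hx => ⟨hx.1, hcon x hx.1 hx.2⟩)
  · rintro ⟨x, hA, hY, hX⟩ he
    have : x ∈ A ∩ X := by rw [he]; exact ⟨hA, hY⟩
    exact hX this.2

theorem mem_cdom {q : Cond} {x : Ordinal.{0}} : x ∈ cdom q ↔ ∃ b, q x = some b :=
  Option.isSome_iff_exists

def subC (p q : Cond) : Prop := ∀ i b, p i = some b → q i = some b

theorem subC.cdom {p q : Cond} (h : subC p q) : cdom p ⊆ cdom q := by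
  intro x hx
  obtain ⟨b, hb⟩ := mem_cdom.1 hx
  exact mem_cdom.2 ⟨b, h x b hb⟩

theorem unionC_left {p q : Cond} : subC p (unionC p q) := by
  intro i b h
  simp [unionC, h]

theorem unionC_right {p q : Cond} (h : ∀ x b b', p x = some b → q x = some b' → b = b') :
    subC q (unionC p q) := by
  intro i b hb
  cases hp : p i with
  | none => simp [unionC, hp, hb]
  | some b' => simp [unionC, hp, h i b' b hp hb]

theorem cdom_unionC {p q : Cond} : cdom (unionC p q) = cdom p ∪ cdom q := by
  ext x
  simp only [cdom, unionC, mem_union, mem_ofPred_eq]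
  cases p x <;> simp

theorem subC_unionC {p q w : Cond} (hp : subC p w) (hq : subC q w) : subC (unionC p q) w := by
  intro i b h
  cases hpi : p i with
  | none => exact hq i b (by simpa [unionC, hpi] using h)
  | some b' =>
    have : b' = b := by simpa [unionC, hpi] using h
    exact hp i b (this ▸ hpi)

/-! ### theta -/
section
variable {lam mu : Cardinal.{0}} {K : Set Cardinal.{0}}

theorem theta_spec (hctx : GroundCtx lam mu K) {κ : Cardinal.{0}} (hκ : κ ∈ K) :
    (theta lam K κ).IsRegular ∧ sSup ((K ∩ Set.Iio κ) ∪ {lam}) ≤ theta lam K κ := by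
  have hne : {θ : Cardinal.{0} | θ.IsRegular ∧ sSup ((K ∩ Set.Iio κ) ∪ {lam}) ≤ θ}.Nonempty := by
    obtain ⟨h1, h2, h3⟩ := hctx.2.2.2.2.1 κ hκ
    refine ⟨κ, h1, csSup_le ⟨lam, Or.inr rfl⟩ ?_⟩
    rintro b (hb | hb)
    · exact le_of_lt hb.2
    · rw [mem_singleton_iff.1 hb]; exact h2
  exact csInf_mem hne

theorem theta_reg (hctx : GroundCtx lam mu K) {κ : Cardinal.{0}} (hκ : κ ∈ K) :
    (Cardinal.lift.{1} (theta lam K κ)).IsRegular := (theta_spec hctx hκ).1.lift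

theorem le_theta (hctx : GroundCtx lam mu K) {κ ν : Cardinal.{0}} (hκ : κ ∈ K) (hν : ν ∈ K)
    (h : ν < κ) : ν ≤ theta lam K κ := by
  refine le_trans (le_csSup ?_ (Or.inl ⟨hν, h⟩)) (theta_spec hctx hκ).2
  refine ⟨max κ lam, ?_⟩
  rintro b (hb | hb)
  · exact le_max_of_le_left (le_of_lt hb.2)
  · rw [mem_singleton_iff.1 hb]; exact le_max_right _ _

theorem K_inf (hctx : GroundCtx lam mu K) {κ : Cardinal.{0}} (hκ : κ ∈ K) : ℵ₀ ≤ κ :=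
  (hctx.2.2.2.2.1 κ hκ).1.aleph0_le

theorem smallQ_union {α : Type 1} (hctx : GroundCtx lam mu K) {κ : Cardinal.{0}} (hκ : κ ∈ K)
    {X Y : Set α} (hX : #X < Cardinal.lift.{1} (theta lam K κ))
    (hY : #Y < Cardinal.lift.{1} (theta lam K κ)) :
    #(X ∪ Y : Set α) < Cardinal.lift.{1} (theta lam K κ) :=
  (mk_union_le X Y).trans_lt (add_lt_of_lt (theta_reg hctx hκ).aleph0_le hX hY)

theorem smallQ_biUnion {α : Type 1} (hctx : GroundCtx lam mu K) {κ : Cardinal.{0}} (hκ : κ ∈ K)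
    {ζ : Ordinal.{0}} (hζ : ζ.card < theta lam K κ) {X : Ordinal.{0} → Set α}
    (hX : ∀ η < ζ, #(X η) < Cardinal.lift.{1} (theta lam K κ)) :
    #(⋃ η : Iio ζ, X η : Set α) < Cardinal.lift.{1} (theta lam K κ) := by
  apply (card_iUnion_lt_iff_forall_of_isRegular (theta_reg hctx hκ) ?_).2
  · intro i; exact hX i.1 i.2
  · rw [Cardinal.mk_Iio_ordinal, Cardinal.lift_lt]; exact hζ

theorem inQ_union (hctx : GroundCtx lam mu K) {p q : Cond} (hp : inQ lam mu K p)
    (hq : inQ lam mu K q) : inQ lam mu K (unionC p q) := by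
  refine ⟨?_, fun i hi κ hκ => ?_⟩
  · rw [cdom_unionC]; exact union_subset hp.1 hq.1
  · rw [cdom_unionC, inter_union_distrib_left]
    exact smallQ_union hctx hκ (hp.2 i hi κ hκ) (hq.2 i hi κ hκ)

theorem condLe_trans (hctx : GroundCtx lam mu K) {p q r : Cond} (h1 : condLe lam mu K p q)
    (h2 : condLe lam mu K q r) : condLe lam mu K p r := by
  have s1 : subC p q := h1.1
  have s2 : subC q r := h2.1
  have s3 : subC p r := fun i b h => s2 i b (s1 i b h)
  refine ⟨s3, fun κ hκ => ?_⟩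
  refine (mk_le_mk_of_subset ?_).trans_lt (smallQ_union hctx hκ (h1.2 κ hκ) (h2.2 κ hκ))
  rintro A ⟨hA, hg⟩
  obtain ⟨⟨y, hyA, hy⟩, x, hxA, hx, hxn⟩ := (grows_iff s3.cdom).1 hg
  by_cases hxq : x ∈ cdom q
  · exact Or.inl ⟨hA, (grows_iff s1.cdom).2 ⟨⟨y, hyA, hy⟩, x, hxA, hxq, hxn⟩⟩
  · exact Or.inr ⟨hA, (grows_iff s2.cdom).2 ⟨⟨y, hyA, s1.cdom hy⟩, x, hxA, hx, hxq⟩⟩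

/-- least upper bound property -/
theorem condLe_union (hctx : GroundCtx lam mu K) {p q w : Cond} (h1 : condLe lam mu K p w)
    (h2 : condLe lam mu K q w) : condLe lam mu K (unionC p q) w := by
  have s1 : subC p w := h1.1
  have s2 : subC q w := h2.1
  have s3 := subC_unionC s1 s2
  refine ⟨s3, fun κ hκ => ?_⟩
  refine (mk_le_mk_of_subset ?_).trans_lt (smallQ_union hctx hκ (h1.2 κ hκ) (h2.2 κ hκ))
  rintro A ⟨hA, hg⟩
  obtain ⟨⟨y, hyA, hy⟩, x, hxA, hx, hxn⟩ := (grows_iff s3.cdom).1 hg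
  rw [cdom_unionC] at hy hxn
  rcases hy with hy | hy
  · exact Or.inl ⟨hA, (grows_iff s1.cdom).2 ⟨⟨y, hyA, hy⟩, x, hxA, hx, fun h => hxn (Or.inl h)⟩⟩
  · exact Or.inr ⟨hA, (grows_iff s2.cdom).2 ⟨⟨y, hyA, hy⟩, x, hxA, hx, fun h => hxn (Or.inr h)⟩⟩

end

/-! ### The gluing -/

def met (κ : Cardinal.{0}) (r : Ordinal.{0} → Cond) (η x : Ordinal.{0}) : Prop :=
  (Ecl κ x ∩ cdom (r η)).Nonempty

def qof (κ : Cardinal.{0}) (r : Ordinal.{0} → Cond) (ζ : Ordinal.{0}) : Cond := fun x =>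
  if ∃ η < ζ, met κ r η x then r (sInf {η | met κ r η x}) x else none

theorem met_congr {κ : Cardinal.{0}} {r : Ordinal.{0} → Cond} {η x y : Ordinal.{0}} (h : y ∈ Ecl κ x) :
    met κ r η y ↔ met κ r η x := by
  unfold met; rw [Ecl_eq h]

theorem met_of {κ : Cardinal.{0}} {r : Ordinal.{0} → Cond} {η x : Ordinal.{0}} (h : x ∈ cdom (r η)) :
    met κ r η x := ⟨x, Ecl_self κ x, h⟩

theorem qof_some {κ : Cardinal.{0}} {r : Ordinal.{0} → Cond} {ζ x : Ordinal.{0}} {b : Bool} :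
    qof κ r ζ x = some b ↔ ∃ η < ζ, (∀ η' < η, ¬ met κ r η' x) ∧ r η x = some b := by
  unfold qof
  constructor
  · intro h
    split_ifs at h with hex
    obtain ⟨η, hη, hm⟩ := hex
    exact ⟨_, (csInf_le' (s := {η | met κ r η x}) hm).trans_lt hη, fun η' h' => notMem_of_lt_csInf' (s := {η | met κ r η x}) h', h⟩
  · rintro ⟨η, hη, hmin, hb⟩
    have hm : met κ r η x := met_of (mem_cdom.2 ⟨b, hb⟩)
    rw [if_pos ⟨η, hη, hm⟩]
    have : sInf {η | met κ r η x} = η := by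
      apply le_antisymm (csInf_le' (s := {η | met κ r η x}) hm)
      apply le_csInf ⟨η, hm⟩
      intro c hc
      by_contra h
      exact hmin c (not_le.1 h) hc
    rw [this, hb]

theorem qof_dom {κ : Cardinal.{0}} {r : Ordinal.{0} → Cond} {ζ x : Ordinal.{0}} :
    x ∈ cdom (qof κ r ζ) ↔ ∃ η < ζ, (∀ η' < η, ¬ met κ r η' x) ∧ x ∈ cdom (r η) := by
  rw [mem_cdom]
  constructor
  · rintro ⟨b, hb⟩
    obtain ⟨η, h1, h2, h3⟩ := qof_some.1 hb
    exact ⟨η, h1, h2, mem_cdom.2 ⟨b, h3⟩⟩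
  · rintro ⟨η, h1, h2, h3⟩
    obtain ⟨b, hb⟩ := mem_cdom.1 h3
    exact ⟨b, qof_some.2 ⟨η, h1, h2, hb⟩⟩

theorem qof_congr {κ : Cardinal.{0}} {r r' : Ordinal.{0} → Cond} {ζ : Ordinal.{0}}
    (h : ∀ η < ζ, r η = r' η) : qof κ r ζ = qof κ r' ζ := by
  have key : ∀ (r r' : Ordinal.{0} → Cond), (∀ η < ζ, r η = r' η) →
      ∀ x b, qof κ r ζ x = some b → qof κ r' ζ x = some b := by
    intro r r' h x b hb
    obtain ⟨η, h1, h2, h3⟩ := qof_some.1 hb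
    refine qof_some.2 ⟨η, h1, fun η' hη' hm => h2 η' hη' ?_, h η h1 ▸ h3⟩
    unfold met at *
    rw [h η' (hη'.trans h1)]
    exact hm
  funext x
  apply Option.ext
  intro b
  exact ⟨key r r' h x b, key r' r (fun η hη => (h η hη).symm) x b⟩

theorem qof_mono {κ : Cardinal.{0}} {r : Ordinal.{0} → Cond} {ξ ζ : Ordinal.{0}} (h : ξ ≤ ζ) :
    subC (qof κ r ξ) (qof κ r ζ) := by
  intro x b hb
  obtain ⟨η, h1, h2⟩ := qof_some.1 hb
  exact qof_some.2 ⟨η, h1.trans_le h, h2⟩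

/-- stability on classes already met -/
theorem qof_stable {κ : Cardinal.{0}} {r : Ordinal.{0} → Cond} {ξ ζ η x : Ordinal.{0}} {b : Bool} (hη : η < ξ)
    (hm : met κ r η x) (hb : qof κ r ζ x = some b) : qof κ r ξ x = some b := by
  obtain ⟨η₁, h1, h2, h3⟩ := qof_some.1 hb
  refine qof_some.2 ⟨η₁, lt_of_le_of_lt ?_ hη, h2, h3⟩
  by_contra hcon
  exact h2 η (not_le.1 hcon) hm

theorem qof_stable_dom {κ : Cardinal.{0}} {r : Ordinal.{0} → Cond} {ξ ζ η x : Ordinal.{0}} (hη : η < ξ)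
    (hm : met κ r η x) (hb : x ∈ cdom (qof κ r ζ)) : x ∈ cdom (qof κ r ξ) := by
  obtain ⟨b, hb⟩ := mem_cdom.1 hb
  exact mem_cdom.2 ⟨b, qof_stable hη hm hb⟩

/-- a met class is represented in q -/
theorem met_qof {κ : Cardinal.{0}} {r : Ordinal.{0} → Cond} {ζ η x : Ordinal.{0}} (hη : η < ζ)
    (hm : met κ r η x) : (Ecl κ x ∩ cdom (qof κ r ζ)).Nonempty := by
  have hm' : met κ r (sInf {η | met κ r η x}) x := csInf_mem (s := {η | met κ r η x}) ⟨η, hm⟩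
  obtain ⟨y, hy, hyr⟩ := hm'
  refine ⟨y, hy, qof_dom.2 ⟨_, (csInf_le' (s := {η | met κ r η x}) hm).trans_lt hη, fun η' h' hmy => ?_, hyr⟩⟩
  exact notMem_of_lt_csInf' (s := {η | met κ r η x}) h' ((met_congr hy).1 hmy)

theorem qof_met {κ : Cardinal.{0}} {r : Ordinal.{0} → Cond} {ζ x y : Ordinal.{0}} (hy : y ∈ Ecl κ x)
    (h : y ∈ cdom (qof κ r ζ)) : ∃ η < ζ, met κ r η x := by
  obtain ⟨η, h1, _, h3⟩ := qof_dom.1 h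
  exact ⟨η, h1, (met_congr hy).1 (met_of h3)⟩

/-- new points -/
theorem qof_new {κ : Cardinal.{0}} {r : Ordinal.{0} → Cond} {ξ ζ x : Ordinal.{0}}
    (h : x ∈ cdom (qof κ r ζ)) (hn : x ∉ cdom (qof κ r ξ)) :
    ∃ η < ζ, ξ ≤ η ∧ x ∈ cdom (r η) ∧ x ∉ cdom (qof κ r η) ∧ ∀ η' < η, ¬ met κ r η' x := by
  obtain ⟨η, h1, h2, h3⟩ := qof_dom.1 h
  refine ⟨η, h1, ?_, h3, ?_, h2⟩
  · by_contra hcon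
    exact hn (qof_dom.2 ⟨η, not_le.1 hcon, h2, h3⟩)
  · intro hx
    obtain ⟨η', h', hm⟩ := qof_met (Ecl_self κ x) hx
    exact h2 η' h' hm

/-! ### Properties of the gluing along a good sequence -/

structure Good (lam mu : Cardinal.{0}) (K : Set Cardinal.{0}) (κ : Cardinal.{0})
    (r : Ordinal.{0} → Cond) (ζ : Ordinal.{0}) : Prop where
  ctx : GroundCtx lam mu K
  mem : κ ∈ K
  zero : inQ lam mu K (r 0)
  inq : ∀ η, 0 < η → η < ζ → inQ lam mu K (r η)
  le : ∀ η, 0 < η → η < ζ → condLe lam mu K (qof κ r η) (r η)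
  card : ζ.card < κ

section
variable {lam mu : Cardinal.{0}} {K : Set Cardinal.{0}} {κ : Cardinal.{0}}
  {r : Ordinal.{0} → Cond} {ζ : Ordinal.{0}}

theorem Good.inq' (h : Good lam mu K κ r ζ) {η : Ordinal.{0}} (hη : η < ζ) :
    inQ lam mu K (r η) := by
  rcases eq_or_ne η 0 with rfl | h0
  · exact h.zero
  · exact h.inq η (pos_iff_ne_zero.2 h0) hη

theorem Good.sub (h : Good lam mu K κ r ζ) {η : Ordinal.{0}} (h0 : 0 < η) (hη : η < ζ) :
    subC (qof κ r η) (r η) := (h.le η h0 hη).1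

theorem Good.card_lt (h : Good lam mu K κ r ζ) {ν : Cardinal.{0}} (hν : ν ∈ K) (hlt : κ < ν) :
    ζ.card < theta lam K ν := h.card.trans_le (le_theta h.ctx hν h.mem hlt)

theorem Good.mono (h : Good lam mu K κ r ζ) {ξ : Ordinal.{0}} (hξ : ξ ≤ ζ) :
    Good lam mu K κ r ξ where
  ctx := h.ctx
  mem := h.mem
  zero := h.zero
  inq := fun η h0 hη => h.inq η h0 (hη.trans_le hξ)
  le := fun η h0 hη => h.le η h0 (hη.trans_le hξ)
  card := (Ordinal.card_le_card hξ).trans_lt h.card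

theorem Good.qof_inQ (h : Good lam mu K κ r ζ) : inQ lam mu K (qof κ r ζ) := by
  refine ⟨?_, fun i hi ν hν => ?_⟩
  · intro x hx
    obtain ⟨η, h1, h2, h3⟩ := qof_dom.1 hx
    exact (h.inq' h1).1 h3
  rcases le_or_gt ν κ with hle | hgt
  · rcases (Ecl ν i ∩ cdom (qof κ r ζ)).eq_empty_or_nonempty with he | ⟨x, hxi, hx⟩
    · rw [he, mk_emptyCollection]
      exact (theta_reg h.ctx hν).pos
    · obtain ⟨η, h1, h2, h3⟩ := qof_dom.1 hx
      refine (mk_le_mk_of_subset ?_).trans_lt ((h.inq' h1).2 i hi ν hν)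
      rintro y ⟨hyi, hy⟩
      refine ⟨hyi, ?_⟩
      obtain ⟨η', h1', h2', h3'⟩ := qof_dom.1 hy
      have hyx : y ∈ Ecl κ x := by
        have : y ∈ Ecl ν x := by rw [Ecl_eq hxi]; exact hyi
        exact Ecl_mono (K_inf h.ctx h.mem) hle x this
      rcases lt_trichotomy η η' with hl | rfl | hl
      · exact absurd ((met_congr hyx).2 (met_of h3)) (h2' η hl)
      · exact h3'
      · exact absurd ((met_congr hyx).1 (met_of h3')) (h2 η' hl)
  · refine (mk_le_mk_of_subset ?_).trans_lt (smallQ_biUnion h.ctx hν (h.card_lt hν hgt)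
      (X := fun η => Ecl ν i ∩ cdom (r η)) (fun η hη => (h.inq' hη).2 i hi ν hν))
    rintro y ⟨hyi, hy⟩
    obtain ⟨η, h1, h2, h3⟩ := qof_dom.1 hy
    exact mem_iUnion.2 ⟨⟨η, h1⟩, hyi, h3⟩

theorem qof_noGrow {ν : Cardinal.{0}} (hκ : ℵ₀ ≤ κ) (hν : ν ≤ κ) (i : Ordinal.{0})
    {ξ : Ordinal.{0}} (hξ : ξ ≤ ζ) :
    ¬ grows (Ecl ν i) (cdom (qof κ r ξ)) (cdom (qof κ r ζ)) := by
  intro hg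
  obtain ⟨⟨y, hyA, hy⟩, x, hxA, hx, hxn⟩ := (grows_iff (qof_mono hξ).cdom).1 hg
  have hyx : y ∈ Ecl κ x := Ecl_mono hκ hν x (by rw [Ecl_eq hxA]; exact hyA)
  obtain ⟨η, hη, hm⟩ := qof_met hyx hy
  exact hxn (qof_stable_dom hη hm hx)

theorem Good.qof_le (h : Good lam mu K κ r ζ) {ξ : Ordinal.{0}} (h0 : 0 < ξ) (hξ : ξ ≤ ζ) :
    condLe lam mu K (qof κ r ξ) (qof κ r ζ) := by
  refine ⟨qof_mono hξ, fun ν hν => ?_⟩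
  rcases le_or_gt ν κ with hle | hgt
  · have : growClasses mu ν (cdom (qof κ r ξ)) (cdom (qof κ r ζ)) = ∅ := by
      ext A
      simp only [mem_empty_iff_false, iff_false]
      rintro ⟨⟨i, _, rfl⟩, hg⟩
      exact qof_noGrow (K_inf h.ctx h.mem) hle i hξ hg
    rw [this, mk_emptyCollection]
    exact (theta_reg h.ctx hν).pos
  · refine (mk_le_mk_of_subset ?_).trans_lt (smallQ_biUnion h.ctx hν (h.card_lt hν hgt)
      (X := fun η => if 0 < η then growClasses mu ν (cdom (qof κ r η)) (cdom (r η)) else ∅) ?_)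
    · rintro A ⟨hA, hg⟩
      obtain ⟨⟨y, hyA, hy⟩, x, hxA, hx, hxn⟩ := (grows_iff (qof_mono hξ).cdom).1 hg
      obtain ⟨η, hη, hξη, hxr, hxq, -⟩ := qof_new hx hxn
      have h0η := h0.trans_le hξη
      refine mem_iUnion.2 ⟨⟨η, hη⟩, ?_⟩
      rw [if_pos h0η]
      exact ⟨hA, (grows_iff (h.sub h0η hη).cdom).2
        ⟨⟨y, hyA, (qof_mono hξη).cdom hy⟩, x, hxA, hxr, hxq⟩⟩
    · intro η hη
      split_ifs with h0η
      · exact (h.le η h0η hη).2 ν hν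
      · rw [mk_emptyCollection]
        exact (theta_reg h.ctx hν).pos

theorem Good.sub_succ (h : Good lam mu K κ r ζ) {ξ : Ordinal.{0}} (h0 : 0 < ξ) (hξ : ξ < ζ) :
    subC (qof κ r (Order.succ ξ)) (r ξ) := by
  intro x b hb
  obtain ⟨η, h1, h2, h3⟩ := qof_some.1 hb
  rcases (Order.lt_succ_iff.1 h1).eq_or_lt with rfl | hlt
  · exact h3
  · exact h.sub h0 hξ x b (qof_some.2 ⟨η, hlt, h2, h3⟩)

/-- On classes met by `r ξ`, everything in `q ζ` is in `r ξ`. -/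
theorem Good.q_in_r (h : Good lam mu K κ r ζ) {ξ ζ' : Ordinal.{0}} (h0 : 0 < ξ) (hξ : ξ < ζ)
    {x : Ordinal.{0}} {b : Bool} (hm : met κ r ξ x) (hb : qof κ r ζ' x = some b) :
    r ξ x = some b :=
  h.sub_succ h0 hξ x b (qof_stable (Order.lt_succ ξ) hm hb)

theorem Good.agree (h : Good lam mu K κ r ζ) {ξ : Ordinal.{0}} (h0 : 0 < ξ) (hξ : ξ < ζ)
    (x : Ordinal.{0}) (b b' : Bool) (hb : r ξ x = some b) (hb' : qof κ r ζ x = some b') :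
    b = b' := by
  have := h.q_in_r h0 hξ (met_of (mem_cdom.2 ⟨b, hb⟩)) hb'
  rw [hb] at this
  exact Option.some.inj this

/-- Points of `r ξ` outside `q (ξ+1)` lie in classes already represented in `q ξ`. -/
theorem Good.new_pt (h : Good lam mu K κ r ζ) {ξ : Ordinal.{0}} {x : Ordinal.{0}}
    (hx : x ∈ cdom (r ξ)) (hn : x ∉ cdom (qof κ r (Order.succ ξ))) : ∃ η < ξ, met κ r η x := by
  by_contra hcon
  push Not at hcon
  exact hn (qof_dom.2 ⟨ξ, Order.lt_succ ξ, hcon, hx⟩)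

theorem Good.q_le_union (h : Good lam mu K κ r ζ) {ξ : Ordinal.{0}} (h0 : 0 < ξ) (hξ : ξ < ζ) :
    condLe lam mu K (qof κ r ζ) (unionC (r ξ) (qof κ r ζ)) := by
  have hs : subC (qof κ r ζ) (unionC (r ξ) (qof κ r ζ)) := unionC_right (h.agree h0 hξ)
  refine ⟨hs, fun ν hν => ?_⟩
  refine (mk_le_mk_of_subset ?_).trans_lt ((h.le ξ h0 hξ).2 ν hν)
  rintro A ⟨⟨i, hi, rfl⟩, hg⟩
  obtain ⟨⟨y, hyA, hy⟩, x, hxA, hx, hxn⟩ := (grows_iff hs.cdom).1 hg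
  refine ⟨⟨i, hi, rfl⟩, (grows_iff (h.sub h0 hξ).cdom).2 ⟨?_, x, hxA, ?_, ?_⟩⟩
  · have hxr : x ∈ cdom (r ξ) := by
      rw [cdom_unionC] at hx
      exact hx.resolve_right hxn
    obtain ⟨η, hη, hm⟩ := h.new_pt hxr (fun hh => hxn ((qof_mono (Order.succ_le_of_lt hξ)).cdom hh))
    rcases le_total κ ν with hle | hle
    · obtain ⟨z, hz, hzq⟩ := met_qof hη hm
      refine ⟨z, ?_, hzq⟩
      rw [← Ecl_eq hxA]
      exact Ecl_mono (K_inf h.ctx hν) hle x hz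
    · have hyx : y ∈ Ecl κ x :=
        Ecl_mono (K_inf h.ctx h.mem) hle x (by rw [Ecl_eq hxA]; exact hyA)
      exact ⟨y, hyA, qof_stable_dom hη ((met_congr hyx).2 hm) hy⟩
  · rw [cdom_unionC] at hx
    exact hx.resolve_right hxn
  · exact fun hh => hxn ((qof_mono hξ.le).cdom hh)

theorem Good.r_le_union (h : Good lam mu K κ r ζ) {ξ : Ordinal.{0}} (h0 : 0 < ξ) (hξ : ξ < ζ) :
    condLe lam mu K (r ξ) (unionC (r ξ) (qof κ r ζ)) := by
  have hs : subC (r ξ) (unionC (r ξ) (qof κ r ζ)) := unionC_left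
  refine ⟨hs, fun ν hν => ?_⟩
  have key : ∀ x, x ∈ cdom (unionC (r ξ) (qof κ r ζ)) → x ∉ cdom (r ξ) →
      x ∈ cdom (qof κ r ζ) ∧ ¬ met κ r ξ x := by
    intro x hx hxn
    rw [cdom_unionC] at hx
    have hxq := hx.resolve_left hxn
    refine ⟨hxq, fun hm => hxn ?_⟩
    obtain ⟨b, hb⟩ := mem_cdom.1 hxq
    exact mem_cdom.2 ⟨b, h.q_in_r h0 hξ hm hb⟩
  rcases le_or_gt ν κ with hle | hgt
  · have : growClasses mu ν (cdom (r ξ)) (cdom (unionC (r ξ) (qof κ r ζ))) = ∅ := by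
      ext A
      simp only [mem_empty_iff_false, iff_false]
      rintro ⟨⟨i, _, rfl⟩, hg⟩
      obtain ⟨⟨y, hyA, hy⟩, x, hxA, hx, hxn⟩ := (grows_iff hs.cdom).1 hg
      have hyx : y ∈ Ecl κ x :=
        Ecl_mono (K_inf h.ctx h.mem) hle x (by rw [Ecl_eq hxA]; exact hyA)
      exact (key x hx hxn).2 ((met_congr hyx).1 (met_of hy))
    rw [this, mk_emptyCollection]
    exact (theta_reg h.ctx hν).pos
  · refine (mk_le_mk_of_subset ?_).trans_lt (smallQ_biUnion h.ctx hν (h.card_lt hν hgt)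
      (X := fun η => if 0 < η then growClasses mu ν (cdom (qof κ r η)) (cdom (r η)) else ∅) ?_)
    · rintro A ⟨⟨i, hi, rfl⟩, hg⟩
      obtain ⟨⟨y, hyA, hy⟩, x, hxA, hx, hxn⟩ := (grows_iff hs.cdom).1 hg
      obtain ⟨hxq, hnm⟩ := key x hx hxn
      have hxq' : x ∉ cdom (qof κ r (Order.succ ξ)) :=
        fun hh => hxn ((h.sub_succ h0 hξ).cdom hh)
      obtain ⟨η, hη, hξη, hxr, hxη, -⟩ := qof_new hxq hxq'
      have hξη' : ξ < η := Order.succ_le_iff.1 hξη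
      have h0η := h0.trans hξη'
      refine mem_iUnion.2 ⟨⟨η, hη⟩, ?_⟩
      rw [if_pos h0η]
      refine ⟨⟨i, hi, rfl⟩, (grows_iff (h.sub h0η hη).cdom).2 ⟨?_, x, hxA, hxr, hxη⟩⟩
      obtain ⟨z, hz, hzq⟩ := met_qof hξη' (met_of (κ := κ) hy)
      refine ⟨z, ?_, hzq⟩
      rw [← Ecl_eq hyA]
      exact Ecl_mono (K_inf h.ctx hν) hgt.le y hz
    · intro η hη
      split_ifs with h0η
      · exact (h.le η h0η hη).2 ν hν
      · rw [mk_emptyCollection]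
        exact (theta_reg h.ctx hν).pos

theorem Good.apr (h : Good lam mu K κ r ζ) {ξ : Ordinal.{0}} (h0 : 0 < ξ) (hξ : ξ < ζ) :
    condLeApr lam mu K κ (qof κ r ζ) (unionC (r ξ) (qof κ r ζ)) := by
  refine ⟨h.q_le_union h0 hξ, fun x hx => ?_⟩
  rw [cdom_unionC] at hx
  rcases hx with hx | hx
  · exact met_qof hξ (met_of hx)
  · exact ⟨x, Ecl_self κ x, hx⟩

/-- The non-pure part of `r ξ`. -/
def apart (κ : Cardinal.{0}) (r : Ordinal.{0} → Cond) (ξ : Ordinal.{0}) : Set (Ordinal.{0} × Bool) :=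
  {z | r ξ z.1 = some z.2 ∧ z.1 ∉ cdom (qof κ r (Order.succ ξ))}

theorem Good.apart_card (h : Good lam mu K κ r ζ) {ξ : Ordinal.{0}} (h0 : 0 < ξ) (hξ : ξ < ζ) :
    #(apart κ r ξ) < Cardinal.lift.{1} (theta lam K κ) := by
  have hsub : (Prod.fst '' apart κ r ξ) ⊆
      ⋃ A ∈ growClasses mu κ (cdom (qof κ r ξ)) (cdom (r ξ)), A ∩ cdom (r ξ) := by
    rintro _ ⟨⟨x, b⟩, ⟨hb, hn⟩, rfl⟩
    dsimp only at hb hn ⊢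
    have hx : x ∈ cdom (r ξ) := mem_cdom.2 ⟨b, hb⟩
    obtain ⟨η, hη, hm⟩ := h.new_pt hx hn
    refine mem_biUnion (x := Ecl κ x) ⟨⟨x, (h.inq' hξ).1 hx, rfl⟩,
      (grows_iff (h.sub h0 hξ).cdom).2 ⟨met_qof hη hm, x, Ecl_self κ x, hx, ?_⟩⟩ ⟨Ecl_self κ x, hx⟩
    exact fun hh => hn ((qof_mono (Order.le_succ ξ)).cdom hh)
  have hinj : Set.InjOn Prod.fst (apart κ r ξ) := by
    rintro ⟨x, b⟩ ⟨hb, -⟩ ⟨x', b'⟩ ⟨hb', -⟩ hxx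
    dsimp only at hxx hb hb'
    subst hxx
    rw [hb] at hb'
    rw [Option.some.inj hb']
  rw [← mk_image_eq_of_injOn _ _ hinj]
  refine (mk_le_mk_of_subset hsub).trans_lt ?_
  apply (card_biUnion_lt_iff_forall_of_isRegular (theta_reg h.ctx h.mem)
    ((h.le ξ h0 hξ).2 κ h.mem)).2
  rintro A ⟨⟨i, hi, rfl⟩, -⟩
  exact (h.inq' hξ).2 i hi κ h.mem

theorem Good.compat (h : Good lam mu K κ r ζ) {ξ ζ' : Ordinal.{0}} (h0 : 0 < ξ) (hξ : ξ < ζ')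
    (hζ : ζ' < ζ)
    (hcc : ∀ y ∈ apart κ r ξ, ∀ z ∈ apart κ r ζ', z.1 ∈ Ecl (theta lam K κ) y.1 →
      ∀ w : Ordinal.{0} × Bool, w.1 ∈ Ecl (theta lam K κ) y.1 →
        (w ∈ apart κ r ξ ↔ w ∈ apart κ r ζ')) :
    compatQ lam mu K (r ξ) (r ζ') := by
  have h0' := h0.trans hξ
  have hξζ := hξ.trans hζ
  have hG := h.mono hζ.le
  have hq_sub := h.sub h0' hζ
  -- classes met by `r ξ`
  have hst : ∀ {x}, met κ r ξ x → x ∉ cdom (qof κ r ζ') → x ∉ cdom (qof κ r (Order.succ ζ')) :=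
    fun hm hn hh => hn (qof_stable_dom hξ hm hh)
  have hag : ∀ x b b', r ξ x = some b → r ζ' x = some b' → b = b' := by
    intro x b b' hb hb'
    have hx : x ∈ cdom (r ξ) := mem_cdom.2 ⟨b, hb⟩
    by_cases hxq : x ∈ cdom (qof κ r ζ')
    · obtain ⟨c, hc⟩ := mem_cdom.1 hxq
      have e1 := h.q_in_r h0 hξζ (met_of hx) hc
      have e2 := hq_sub x c hc
      rw [hb] at e1; rw [hb'] at e2
      exact (Option.some.inj e1).trans (Option.some.inj e2).symm
    · have m1 : (x, b) ∈ apart κ r ξ :=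
        ⟨hb, fun hh => hxq ((qof_mono (Order.succ_le_of_lt hξ)).cdom hh)⟩
      have m2 : (x, b') ∈ apart κ r ζ' := ⟨hb', hst (met_of hx) hxq⟩
      have m3 := (hcc _ m1 _ m2 (Ecl_self _ x) (x, b) (Ecl_self _ x)).1 m1
      have := m3.1
      dsimp only at this
      rw [hb'] at this
      exact (Option.some.inj this).symm
  have s1 : subC (r ξ) (unionC (r ξ) (r ζ')) := unionC_left
  have s2 : subC (r ζ') (unionC (r ξ) (r ζ')) := unionC_right hag
  have s3 : subC (r ξ) (unionC (r ξ) (qof κ r ζ')) := unionC_left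
  have s4 : subC (qof κ r ζ') (unionC (r ξ) (qof κ r ζ')) := unionC_right (hG.agree h0 hξ)
  -- key dichotomy
  have key : ∀ ν ∈ K, ∀ i : Ordinal.{0}, ∀ x ∈ Ecl ν i, ∀ y ∈ Ecl ν i, x ∈ cdom (r ξ) →
      y ∈ cdom (r ζ') → (Ecl ν i ∩ cdom (qof κ r ζ')).Nonempty ∨
        (x ∈ cdom (r ζ') ∧ y ∈ cdom (r ξ)) := by
    intro ν hν i x hxi y hyi hx hy
    rcases le_or_gt κ ν with hle | hlt
    · left
      obtain ⟨z, hz, hzq⟩ := met_qof hξ (met_of (κ := κ) hx)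
      refine ⟨z, ?_, hzq⟩
      rw [← Ecl_eq hxi]
      exact Ecl_mono (K_inf h.ctx hν) hle x hz
    · by_cases hne : (Ecl ν i ∩ cdom (qof κ r ζ')).Nonempty
      · exact Or.inl hne
      right
      have hnq : ∀ z ∈ Ecl ν i, z ∉ cdom (qof κ r ζ') := fun z hz hh => hne ⟨z, hz, hh⟩
      have hyx : y ∈ Ecl ν x := by rw [Ecl_eq hxi]; exact hyi
      have hyxκ : y ∈ Ecl κ x := Ecl_mono (K_inf h.ctx h.mem) hlt.le x hyx
      have hyxθ : y ∈ Ecl (theta lam K κ) x :=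
        Ecl_mono (theta_spec h.ctx h.mem).1.aleph0_le (le_theta h.ctx h.mem hν hlt) x hyx
      obtain ⟨b, hb⟩ := mem_cdom.1 hx
      obtain ⟨b', hb'⟩ := mem_cdom.1 hy
      have m1 : (x, b) ∈ apart κ r ξ :=
        ⟨hb, fun hh => hnq x hxi ((qof_mono (Order.succ_le_of_lt hξ)).cdom hh)⟩
      have m2 : (y, b') ∈ apart κ r ζ' :=
        ⟨hb', hst ((met_congr hyxκ).2 (met_of hx)) (hnq y hyi)⟩
      have m3 := (hcc _ m1 _ m2 hyxθ (x, b) (Ecl_self _ x)).1 m1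
      have m4 := (hcc _ m1 _ m2 hyxθ (y, b') hyxθ).2 m2
      exact ⟨mem_cdom.2 ⟨b, m3.1⟩, mem_cdom.2 ⟨b', m4.1⟩⟩
  refine ⟨unionC (r ξ) (r ζ'), inQ_union h.ctx (h.inq' hξζ) (h.inq' hζ), ⟨s1, ?_⟩, ⟨s2, ?_⟩⟩
  · intro ν hν
    refine (mk_le_mk_of_subset ?_).trans_lt (smallQ_union h.ctx hν ((h.le ζ' h0' hζ).2 ν hν)
      ((hG.r_le_union h0 hξ).2 ν hν))
    rintro A ⟨⟨i, hi, rfl⟩, hg⟩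
    obtain ⟨⟨y, hyA, hy⟩, x, hxA, hx, hxn⟩ := (grows_iff s1.cdom).1 hg
    rw [cdom_unionC] at hx
    have hx := hx.resolve_left hxn
    by_cases hxq : x ∈ cdom (qof κ r ζ')
    · exact Or.inr ⟨⟨i, hi, rfl⟩, (grows_iff s3.cdom).2
        ⟨⟨y, hyA, hy⟩, x, hxA, s4.cdom hxq, hxn⟩⟩
    · rcases key ν hν i y hyA x hxA hy hx with hne | hcon
      · exact Or.inl ⟨⟨i, hi, rfl⟩, (grows_iff hq_sub.cdom).2 ⟨hne, x, hxA, hx, hxq⟩⟩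
      · exact absurd hcon.2 hxn
  · intro ν hν
    refine (mk_le_mk_of_subset ?_).trans_lt ((hG.q_le_union h0 hξ).2 ν hν)
    rintro A ⟨⟨i, hi, rfl⟩, hg⟩
    obtain ⟨⟨y, hyA, hy⟩, x, hxA, hx, hxn⟩ := (grows_iff s2.cdom).1 hg
    rw [cdom_unionC] at hx
    have hx := hx.resolve_right hxn
    rcases key ν hν i x hxA y hyA hx hy with hne | hcon
    · exact ⟨⟨i, hi, rfl⟩, (grows_iff s4.cdom).2
        ⟨hne, x, hxA, s3.cdom hx, fun hh => hxn (hq_sub.cdom hh)⟩⟩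
    · exact absurd hcon.1 hxn

end

/-! ### The recursion -/

/-- What we want of the condition chosen at stage `ζ`. -/
def stepOK (lam mu : Cardinal.{0}) (K : Set Cardinal.{0}) (κ : Cardinal.{0}) (Dec : Cond → Prop)
    (r : Ordinal.{0} → Cond) (ζ : Ordinal.{0}) (s : Cond) : Prop :=
  inQ lam mu K s ∧ condLe lam mu K (qof κ r ζ) s ∧ Dec s ∧
    ∀ η, 0 < η → η < ζ → ¬ compatQ lam mu K (r η) s

theorem stepOK_congr {lam mu : Cardinal.{0}} {K : Set Cardinal.{0}} {κ : Cardinal.{0}}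
    {Dec : Cond → Prop} {r r' : Ordinal.{0} → Cond} {ζ : Ordinal.{0}} {s : Cond}
    (h : ∀ η < ζ, r η = r' η) (hs : stepOK lam mu K κ Dec r ζ s) :
    stepOK lam mu K κ Dec r' ζ s := by
  refine ⟨hs.1, qof_congr h ▸ hs.2.1, hs.2.2.1, fun η h0 hη => h η hη ▸ hs.2.2.2 η h0 hη⟩

theorem exists_seq (lam mu : Cardinal.{0}) (K : Set Cardinal.{0}) (κ : Cardinal.{0})
    (Dec : Cond → Prop) (p : Cond) :
    ∃ r : Ordinal.{0} → Cond, r 0 = p ∧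
      ∀ ζ, 0 < ζ → (∃ s, stepOK lam mu K κ Dec r ζ s) → stepOK lam mu K κ Dec r ζ (r ζ) := by
  let ext : (ζ : Ordinal.{0}) → (∀ η, η < ζ → Cond) → Ordinal.{0} → Cond :=
    fun ζ f η => if h : η < ζ then f η h else p
  let stp : (ζ : Ordinal.{0}) → (∀ η, η < ζ → Cond) → Cond := fun ζ f =>
    if ζ = 0 then p else
      if h : ∃ s, stepOK lam mu K κ Dec (ext ζ f) ζ s then h.choose else p
  let r : Ordinal.{0} → Cond := Ordinal.lt_wf.fix stp
  have hr : ∀ ζ, r ζ = stp ζ (fun η _ => r η) := fun ζ => Ordinal.lt_wf.fix_eq stp ζ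
  have hext : ∀ ζ, ∀ η < ζ, ext ζ (fun η _ => r η) η = r η := by
    intro ζ η hη
    simp only [ext, dif_pos hη]
  refine ⟨r, ?_, ?_⟩
  · rw [hr]; simp [stp]
  · rintro ζ h0 ⟨s, hs⟩
    have hex : ∃ s, stepOK lam mu K κ Dec (ext ζ (fun η _ => r η)) ζ s :=
      ⟨s, stepOK_congr (fun η hη => (hext ζ η hη).symm) hs⟩
    have e : r ζ = hex.choose := by
      rw [hr]
      simp only [stp, if_neg h0.ne', dif_pos hex]
    rw [e]
    exact stepOK_congr (hext ζ) hex.choose_spec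

theorem lift_powerlt_le (θ : Cardinal.{0}) :
    2 ^< Cardinal.lift.{1} θ ≤ Cardinal.lift.{1} (2 ^< θ) := by
  apply powerlt_le.2
  intro x hx
  obtain ⟨y, rfl⟩ := mem_range_lift_of_le hx.le
  have : y < θ := Cardinal.lift_lt.1 hx
  have h2 := Cardinal.lift_le.{1}.2 (le_powerlt 2 this)
  simpa using h2

theorem qof_one {κ : Cardinal.{0}} {r : Ordinal.{0} → Cond} : qof κ r 1 = r 0 := by
  funext x
  apply Option.ext
  intro b
  change qof κ r 1 x = some b ↔ r 0 x = some b
  rw [qof_some]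
  constructor
  · rintro ⟨η, h1, h2, h3⟩
    rw [Ordinal.lt_one_iff_zero.1 h1] at h3
    exact h3
  · intro h
    exact ⟨0, zero_lt_one, fun η' h' => absurd h' not_lt_zero, h⟩
/-- decision lemma: if `κ ∈ K`, `2^{<θ_κ} < κ`, `p ∈ Q`, and `ȧ` is a
name for an ordinal (coded by the predicate `Dec r` = "`r` decides the value of `ȧ`",
which is upward closed, with the deciding conditions dense above `p`), then there are
`q` and `(r_i : i < i*)` with `i* < (2^{<θ_κ})⁺`, `p ≤pr_κ q`, `q ≤apr_κ r_i`, each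
`r_i` deciding `ȧ`, and `{r_i : i < i*}` predense above `q`. -/
theorem stmt17 (lam mu : Cardinal) (K : Set Cardinal) (hctx : GroundCtx lam mu K)
    (κ : Cardinal) (hκ : κ ∈ K) (hsmall : 2 ^< theta lam K κ < κ)
    (p : Cond) (hp : inQ lam mu K p) (Dec : Cond → Prop)
    (hDecUp : ∀ r r', Dec r → inQ lam mu K r' → condLe lam mu K r r' → Dec r')
    (hDecDense : ∀ q', inQ lam mu K q' → condLe lam mu K p q' →
      ∃ r, inQ lam mu K r ∧ condLe lam mu K q' r ∧ Dec r) :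
    ∃ (q : Cond) (istar : Ordinal) (r : Ordinal → Cond),
      inQ lam mu K q ∧ istar < (Order.succ (2 ^< theta lam K κ)).ord ∧
      condLePr lam mu K κ p q ∧
      (∀ i < istar, inQ lam mu K (r i) ∧ condLeApr lam mu K κ q (r i) ∧ Dec (r i)) ∧
      ∀ q', inQ lam mu K q' → condLe lam mu K q q' →
        ∃ i, i < istar ∧ compatQ lam mu K (r i) q' := by
  set c := 2 ^< theta lam K κ with hc
  obtain ⟨r, r0, hr⟩ := exists_seq lam mu K κ Dec p
  have hcard : ∀ ζ : Ordinal.{0}, ζ < (Order.succ c).ord → ζ.card < κ := fun ζ hζ =>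
    (Order.lt_succ_iff.1 (Cardinal.lt_ord.1 hζ)).trans_lt hsmall
  have mkGood : ∀ ζ : Ordinal.{0}, ζ < (Order.succ c).ord →
      (∀ η, 0 < η → η < ζ → stepOK lam mu K κ Dec r η (r η)) → Good lam mu K κ r ζ :=
    fun ζ hζ h => ⟨hctx, hκ, r0 ▸ hp, fun η h0 hη => (h η h0 hη).1,
      fun η h0 hη => (h η h0 hη).2.1, hcard ζ hζ⟩
  by_cases hex : ∃ ζ : Ordinal.{0}, 0 < ζ ∧ ζ < (Order.succ c).ord ∧
      ¬ ∃ s, stepOK lam mu K κ Dec r ζ s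
  · obtain ⟨ζ, ⟨h0, hζ, hno⟩, hmin⟩ := WellFounded.has_min Ordinal.lt_wf
      {ζ : Ordinal.{0} | 0 < ζ ∧ ζ < (Order.succ c).ord ∧ ¬ ∃ s, stepOK lam mu K κ Dec r ζ s} hex
    have hok : ∀ η, 0 < η → η < ζ → stepOK lam mu K κ Dec r η (r η) := by
      intro η h0η hη
      apply hr η h0η
      by_contra hcon
      exact hmin η ⟨h0η, hη.trans hζ, hcon⟩ hη
    have hG := mkGood ζ hζ hok
    have h1 : (1 : Ordinal.{0}) ≤ ζ := Order.one_le_iff_pos.2 h0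
    have hidx : ∀ i < ζ - 1, 0 < 1 + i ∧ 1 + i < ζ := by
      intro i hi
      refine ⟨lt_of_lt_of_le zero_lt_one le_self_add, ?_⟩
      have : 1 + i < 1 + (ζ - 1) := by gcongr
      rwa [Ordinal.add_sub_cancel_of_le h1] at this
    have hpq : condLePr lam mu K κ p (qof κ r ζ) := by
      have e : p = qof κ r 1 := by rw [qof_one, r0]
      rw [e]
      exact ⟨hG.qof_le zero_lt_one h1, fun i => qof_noGrow (K_inf hctx hκ) le_rfl i h1⟩
    refine ⟨qof κ r ζ, ζ - 1, fun i => unionC (r (1 + i)) (qof κ r ζ), hG.qof_inQ,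
      (Ordinal.sub_le_self ζ 1).trans_lt hζ, hpq, ?_, ?_⟩
    · intro i hi
      obtain ⟨a, b⟩ := hidx i hi
      have hin := inQ_union hctx (hG.inq' b) hG.qof_inQ
      exact ⟨hin, hG.apr a b, hDecUp _ _ (hok _ a b).2.2.1 hin (hG.r_le_union a b)⟩
    · intro q' hq' hle
      obtain ⟨s, hs, hqs, hds⟩ := hDecDense q' hq' (condLe_trans hctx hpq.1 hle)
      have hqs' := condLe_trans hctx hle hqs
      have : ∃ η, 0 < η ∧ η < ζ ∧ compatQ lam mu K (r η) s := by
        by_contra hcon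
        push Not at hcon
        exact hno ⟨s, hs, hqs', hds, hcon⟩
      obtain ⟨η, h0η, hη, w, hw, hw1, hw2⟩ := this
      have e : 1 + (η - 1) = η := Ordinal.add_sub_cancel_of_le (Order.one_le_iff_pos.2 h0η)
      refine ⟨η - 1, ?_, w, hw, ?_, condLe_trans hctx hqs hw2⟩
      · by_contra hcon
        have h2 : 1 + (ζ - 1) ≤ 1 + (η - 1) := by gcongr; exact not_lt.1 hcon
        rw [e, Ordinal.add_sub_cancel_of_le h1] at h2
        exact absurd hη (not_lt.2 h2)
      · dsimp only
        rw [e]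
        exact condLe_union hctx hw1 (condLe_trans hctx hqs' hw2)
  · exfalso
    push Not at hex
    have hok : ∀ η, 0 < η → η < (Order.succ c).ord → stepOK lam mu K κ Dec r η (r η) :=
      fun η h0 hη => hr η h0 (hex η h0 hη)
    have hθ : (theta lam K κ).IsRegular := (theta_spec hctx hκ).1
    have hθ' : (Cardinal.lift.{1} (theta lam K κ)).IsRegular := theta_reg hctx hκ
    have hcinf : ℵ₀ ≤ Order.succ c :=
      hθ.aleph0_le.trans ((theta_le_powerlt _).trans (Order.le_succ c))
    have hlim : Order.IsSuccLimit (Order.succ c).ord := Cardinal.isSuccLimit_ord hcinf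
    have hsucc : ∀ η < (Order.succ c).ord, Order.succ η < (Order.succ c).ord :=
      fun η hη => hlim.succ_lt hη
    let s : Setoid (Ordinal.{0} × Bool) :=
      { r := fun y z => z.1 ∈ Ecl (theta lam K κ) y.1
        iseqv := ⟨fun y => Ecl_self _ _,
          fun {y z} h => by rw [Ecl_eq h]; exact Ecl_self _ _,
          fun {x y z} h h' => by rw [← Ecl_eq h]; exact h'⟩ }
    have hG : ∀ η < (Order.succ c).ord, Good lam mu K κ r η := fun η hη =>
      mkGood η hη fun ξ h0 hξ => hok ξ h0 (hξ.trans hη)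
    have hs : ∀ y, #{z | s y z} ≤ 2 ^< Cardinal.lift.{1} (theta lam K κ) := by
      intro y
      refine le_trans ?_ (theta_le_powerlt _)
      have hsub : {z | s y z} ⊆ Set.image (fun x => (x, true)) (Ecl (theta lam K κ) y.1) ∪
          Set.image (fun x => (x, false)) (Ecl (theta lam K κ) y.1) := by
        rintro ⟨z, b⟩ hz
        cases b
        · exact Or.inr ⟨z, hz, rfl⟩
        · exact Or.inl ⟨z, hz, rfl⟩
      have hE := Ecl_card (theta lam K κ) hθ.pos.ne' y.1
      exact (mk_le_mk_of_subset hsub).trans ((mk_union_le _ _).trans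
        (add_le_of_le hθ'.aleph0_le (mk_image_le.trans hE) (mk_image_le.trans hE)))
    obtain ⟨i, j, hij, hcc⟩ := strong_cc (ι := Set.Iio (Order.succ c).ord) _ hθ' s hs
      (fun i => apart κ r (Order.succ i.1))
      (fun i => (hG _ (hsucc _ (hsucc _ i.2))).apart_card (Order.bot_lt_succ _)
        (Order.lt_succ _))
      (by
        rw [Cardinal.mk_Iio_ordinal, Cardinal.card_ord]
        exact (lift_powerlt_le _).trans_lt (Cardinal.lift_lt.2 (Order.lt_succ c)))
    have main : ∀ i j : Set.Iio (Order.succ c).ord, i.1 < j.1 →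
        (∀ y ∈ apart κ r (Order.succ i.1), ∀ z ∈ apart κ r (Order.succ j.1), s y z →
          ∀ w, s y w → (w ∈ apart κ r (Order.succ i.1) ↔ w ∈ apart κ r (Order.succ j.1))) →
        False := by
      intro i j hlt hcc
      have h1 := hsucc _ j.2
      have h2 : Order.succ i.1 < Order.succ j.1 := Order.succ_lt_succ hlt
      have h0 : 0 < Order.succ i.1 := Order.bot_lt_succ _
      exact (hok _ (h0.trans h2) h1).2.2.2 _ h0 h2
        ((hG _ (hsucc _ h1)).compat h0 h2 (Order.lt_succ _) hcc)
    rcases lt_trichotomy i.1 j.1 with h | h | h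
    · exact main i j h hcc
    · exact hij (Subtype.ext h)
    · refine main j i h fun y hy z hz hyz w hw => ?_
      exact (hcc z hz y hy (s.symm hyz) w (s.trans (s.symm hyz) hw)).symm
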